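/- arXiv:2405.10770 — 5 statements merged into one kernel-verified Lean document; each statement's English description precedes it below -/
import Mathlib

section
/- Let H be a complex Hilbert space and let T_1 ≥ T_2 ≥ ⋯ be a decreasing sequence of positive linear contractions on H. Then the sequence of products S_n := T_n T_{n-1} ⋯ T_1 converges in the strong operator topology, i.e., for every ξ ∈ H the sequence (S_n ξ) converges in norm. -/
open Filter Topology
open scoped InnerProductSpace ComplexOrder

/-- `prodSeq T σ n = T (σ n) ∘ ⋯ ∘ T (σ 0)`. -/
noncomputable def prodSeq {H : Type*} [NormedAddCommGroup H] [InnerProductSpace ℂ H]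
    (T : ℕ → H →L[ℂ] H) (σ : ℕ → ℕ) : ℕ → H →L[ℂ] H
  | 0 => T (σ 0)
  | (n + 1) => (T (σ (n + 1))).comp (prodSeq T σ n)

/-- A positive contraction satisfies `T ^ 2 ≤ T`. -/
theorem norm_sq_apply_le_re_inner {H : Type*} [NormedAddCommGroup H] [InnerProductSpace ℂ H]
    {T : H →L[ℂ] H} (hT : T.IsPositive) (hT1 : ‖T‖ ≤ 1) (x : H) :
    ‖T x‖ ^ 2 ≤ (⟪T x, x⟫_ℂ).re := by
  have h := hT.re_inner_nonneg_left (x - T x)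
  have hs : (⟪T (T x), x⟫_ℂ).re = ‖T x‖ ^ 2 := by
    rw [hT.inner_left_eq_inner_right]
    exact inner_self_eq_norm_sq (𝕜 := ℂ) (T x)
  have hs' : (⟪T x, T x⟫_ℂ).re = ‖T x‖ ^ 2 := inner_self_eq_norm_sq (𝕜 := ℂ) (T x)
  have hle : (⟪T (T x), T x⟫_ℂ).re ≤ ‖T x‖ ^ 2 := by
    calc (⟪T (T x), T x⟫_ℂ).re ≤ ‖T (T x)‖ * ‖T x‖ := re_inner_le_norm (𝕜 := ℂ) _ _
      _ ≤ ‖T x‖ * ‖T x‖ := by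
        gcongr
        simpa using T.le_of_opNorm_le hT1 (T x)
      _ = ‖T x‖ ^ 2 := (sq _).symm
  simp only [map_sub, inner_sub_left, inner_sub_right, RCLike.re_to_complex] at h
  linarith

/-- One step of `x ↦ T x` decreases `‖x‖ ^ 2 - ‖y‖ ^ 2 - ‖x - y‖ ^ 2 / 2` up to an error
controlled by the quadratic form of `1 - T` at `y`. -/
theorem half_norm_sub_sq_le_add_half {H : Type*} [NormedAddCommGroup H] [InnerProductSpace ℂ H]
    {T : H →L[ℂ] H} (hT : T.IsPositive) (hT1 : ‖T‖ ≤ 1) (x y : H) :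
    ‖x - y‖ ^ 2 / 2 - ‖x‖ ^ 2 ≤
      ‖T x - y‖ ^ 2 / 2 - ‖T x‖ ^ 2 + (‖y‖ ^ 2 - (⟪T y, y⟫_ℂ).re) / 2 := by
  have h : (⟪T (x + y), x + y⟫_ℂ).re ≤ ‖x + y‖ ^ 2 := by
    calc (⟪T (x + y), x + y⟫_ℂ).re ≤ ‖T (x + y)‖ * ‖x + y‖ := re_inner_le_norm (𝕜 := ℂ) _ _
      _ ≤ ‖x + y‖ * ‖x + y‖ := by
        gcongr
        simpa using T.le_of_opNorm_le hT1 (x + y)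
      _ = ‖x + y‖ ^ 2 := (sq _).symm
  have hyx : (⟪T y, x⟫_ℂ).re = (⟪T x, y⟫_ℂ).re := by
    rw [hT.inner_left_eq_inner_right]
    exact inner_re_symm (𝕜 := ℂ) y (T x)
  have hTx := norm_sq_apply_le_re_inner hT hT1 x
  have h1 := norm_sub_sq (𝕜 := ℂ) x y
  have h2 := norm_sub_sq (𝕜 := ℂ) (T x) y
  have h3 := norm_add_sq (𝕜 := ℂ) x y
  simp only [map_add, inner_add_left, inner_add_right, Complex.add_re] at h
  simp only [RCLike.re_to_complex] at h1 h2 h3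
  linarith

theorem half_norm_sub_sq_le_of_orbit {H : Type*} [NormedAddCommGroup H] [InnerProductSpace ℂ H]
    {T : ℕ → H →L[ℂ] H} (hT : ∀ n, (T n).IsPositive) (hT1 : ∀ n, ‖T n‖ ≤ 1)
    (hanti : ∀ ξ, Antitone fun n => (⟪T n ξ, ξ⟫_ℂ).re)
    {x : ℕ → H} (hx : ∀ n, x (n + 1) = T n (x n)) (k n : ℕ) :
    ‖x n - x (n + k)‖ ^ 2 / 2 ≤ ‖x n‖ ^ 2 - ‖x (n + k)‖ ^ 2 +
      k * (‖x (n + k)‖ ^ 2 - (⟪T (n + k) (x (n + k)), x (n + k)⟫_ℂ).re) / 2 := by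
  induction k generalizing n with
  | zero => simp
  | succ k ih =>
    have h := ih (n + 1)
    rw [show n + 1 + k = n + (k + 1) by omega] at h
    have hstep := half_norm_sub_sq_le_add_half (hT n) (hT1 n) (x n) (x (n + (k + 1)))
    rw [← hx] at hstep
    have hmono := hanti (x (n + (k + 1))) (show n ≤ n + (k + 1) by omega)
    simp only at hmono
    push_cast
    linarith

/-- The increments of a nonnegative antitone sequence are `o(1 / n)` along a subsequence. -/
theorem Antitone.exists_mul_sub_succ_lt {a : ℕ → ℝ} (ha : Antitone a) (h0 : ∀ n, 0 ≤ a n)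
    {ε : ℝ} (hε : 0 < ε) (M : ℕ) : ∃ N ≥ M, N * (a N - a (N + 1)) < ε := by
  by_contra! h
  have hsum : Summable fun n => a n - a (n + 1) := by
    refine summable_of_sum_range_le (c := a 0) (fun n => sub_nonneg.2 (ha n.le_succ)) fun n => ?_
    rw [Finset.sum_range_sub']
    linarith [h0 n]
  refine Real.not_summable_natCast_inv ?_
  rw [← summable_nat_add_iff (M + 1)]
  refine Summable.of_nonneg_of_le (fun n => by positivity) (fun n => ?_)
    (((summable_nat_add_iff (M + 1)).2 hsum).mul_left ε⁻¹)
  have hn := h (n + (M + 1)) (by omega)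
  have hpos : (0 : ℝ) < (n + (M + 1) : ℕ) := by positivity
  rw [inv_mul_eq_div, le_div_iff₀ hε, inv_mul_le_iff₀ hpos]
  exact hn

theorem cauchySeq_of_orbit {H : Type*} [NormedAddCommGroup H] [InnerProductSpace ℂ H]
    {T : ℕ → H →L[ℂ] H} (hT : ∀ n, (T n).IsPositive) (hT1 : ∀ n, ‖T n‖ ≤ 1)
    (hanti : ∀ ξ, Antitone fun n => (⟪T n ξ, ξ⟫_ℂ).re)
    {x : ℕ → H} (hx : ∀ n, x (n + 1) = T n (x n)) : CauchySeq x := by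
  have ha : Antitone fun n => ‖x n‖ ^ 2 := antitone_nat_of_succ_le fun n => by
    rw [hx]
    gcongr
    simpa using (T n).le_of_opNorm_le (hT1 n) (x n)
  have hbdd : BddBelow (Set.range fun n => ‖x n‖ ^ 2) :=
    ⟨0, by rintro _ ⟨n, rfl⟩; positivity⟩
  set L := ⨅ n, ‖x n‖ ^ 2
  have hL : ∀ n, L ≤ ‖x n‖ ^ 2 := ciInf_le hbdd
  refine Metric.cauchySeq_iff'.2 fun ε hε => ?_
  obtain ⟨M, hM⟩ := exists_lt_of_ciInf_lt (lt_add_of_pos_right L (show 0 < ε ^ 2 / 16 by positivity))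
  refine ⟨M, fun n hn => ?_⟩
  obtain ⟨N, hN, hNε⟩ := ha.exists_mul_sub_succ_lt (fun n => by positivity)
    (show 0 < ε ^ 2 / 8 by positivity) n
  have key : ∀ m, M ≤ m → m ≤ N → dist (x m) (x N) < ε / 2 := fun m hMm hmN => by
    obtain ⟨k, rfl⟩ := Nat.exists_eq_add_of_le hmN
    have h := half_norm_sub_sq_le_of_orbit hT hT1 hanti hx k m
    have hq := norm_sq_apply_le_re_inner (hT (m + k)) (hT1 (m + k)) (x (m + k))
    rw [show ‖T (m + k) (x (m + k))‖ = ‖x (m + k + 1)‖ by rw [hx]] at hq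
    have hk : (k : ℝ) * (‖x (m + k)‖ ^ 2 - (⟪T (m + k) (x (m + k)), x (m + k)⟫_ℂ).re) ≤
        (m + k : ℕ) * (‖x (m + k)‖ ^ 2 - ‖x (m + k + 1)‖ ^ 2) := by
      have h1 : ‖x (m + k + 1)‖ ^ 2 ≤ ‖x (m + k)‖ ^ 2 := ha (m + k).le_succ
      have h2 : (k : ℝ) ≤ (m + k : ℕ) := by exact_mod_cast Nat.le_add_left k m
      calc _ ≤ (k : ℝ) * (‖x (m + k)‖ ^ 2 - ‖x (m + k + 1)‖ ^ 2) := by gcongr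
        _ ≤ _ := mul_le_mul_of_nonneg_right h2 (sub_nonneg.2 h1)
    have hmM : ‖x m‖ ^ 2 ≤ ‖x M‖ ^ 2 := ha hMm
    rw [dist_eq_norm]
    refine lt_of_pow_lt_pow_left₀ 2 (by positivity) ?_
    linarith [hL (m + k)]
  calc dist (x n) (x M) ≤ dist (x n) (x N) + dist (x M) (x N) := dist_triangle_right _ _ _
    _ < ε / 2 + ε / 2 := add_lt_add (key n hn hN) (key M le_rfl (hn.trans hN))
    _ = ε := add_halves ε

/-- The Paszkiewicz conjecture: the products `S n = T n ∘ ⋯ ∘ T 0` of a decreasing sequence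
of positive contractions converge in the strong operator topology. -/
theorem paszkiewicz_conjecture
    {H : Type*} [NormedAddCommGroup H] [InnerProductSpace ℂ H] [CompleteSpace H]
    (T : ℕ → H →L[ℂ] H)
    (hpos : ∀ n, ∀ ξ : H, 0 ≤ ⟪(T n) ξ, ξ⟫_ℂ)
    (hcontr : ∀ n, ‖T n‖ ≤ 1)
    (hdec : ∀ n, ∀ ξ : H, ⟪(T (n + 1)) ξ, ξ⟫_ℂ ≤ ⟪(T n) ξ, ξ⟫_ℂ) :
    ∀ ξ : H, ∃ η : H, Tendsto (fun n => prodSeq T id n ξ) atTop (𝓝 η) := by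
  intro ξ
  let x : ℕ → H := fun n => Nat.rec ξ (fun n y => T n y) n
  have hx : ∀ n, prodSeq T id n ξ = x (n + 1) := fun n => by
    induction n with
    | zero => rfl
    | succ n ih => exact congrArg (T (n + 1)) ih
  have hanti : ∀ ζ, Antitone fun n => (⟪T n ζ, ζ⟫_ℂ).re := fun ζ =>
    antitone_nat_of_succ_le fun n => (Complex.le_def.1 (hdec n ζ)).1
  have hT : ∀ n, (T n).IsPositive := fun n => by
    refine (ContinuousLinearMap.isPositive_iff' _).2 ⟨?_, hpos n⟩
    rw [ContinuousLinearMap.isSelfAdjoint_iff_isSymmetric, LinearMap.isSymmetric_iff_inner_map_self_real]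
    exact fun ζ => Complex.conj_eq_iff_im.2 (Complex.le_def.1 (hpos n ζ)).2.symm
  obtain ⟨η, hη⟩ := cauchySeq_tendsto_of_complete
    (cauchySeq_of_orbit hT hcontr hanti (x := x) fun _ => rfl)
  exact ⟨η, by simpa only [hx, Function.comp_def] using hη.comp (tendsto_add_atTop_nat 1)⟩
end

section
/- Let H be a complex Hilbert space, let T_1 ≥ T_2 ≥ ⋯ be a decreasing sequence of positive linear contractions on H, let T be the positive contraction which is the strong operator limit of (T_n), and let P be the orthogonal projection onto the closed subspace {ξ ∈ H : Tξ = ξ}. Then S_n ξ → P ξ in norm for every ξ ∈ H, where S_n := T_n T_{n-1} ⋯ T_1. -/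
open Filter Topology
open scoped InnerProductSpace ComplexOrder

section PositiveContraction

variable {H : Type*} [NormedAddCommGroup H] [InnerProductSpace ℂ H] {A : H →L[ℂ] H}

theorem reApplyInnerSelf_one_sub (A : H →L[ℂ] H) (x : H) :
    (1 - A).reApplyInnerSelf x = ‖x‖ ^ 2 - A.reApplyInnerSelf x := by
  simp only [ContinuousLinearMap.reApplyInnerSelf_apply, sub_apply,
    one_apply_eq_self, inner_sub_left, map_sub, inner_self_eq_norm_sq]

theorem reApplyInnerSelf_le_norm_sq (hc : ‖A‖ ≤ 1) (x : H) :
    A.reApplyInnerSelf x ≤ ‖x‖ ^ 2 := by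
  calc A.reApplyInnerSelf x ≤ ‖A x‖ * ‖x‖ := re_inner_le_norm _ _
    _ ≤ ‖x‖ * ‖x‖ := by
        gcongr
        simpa using A.le_of_opNorm_le hc x
    _ = ‖x‖ ^ 2 := (sq _).symm

theorem reApplyInnerSelf_sub_of_isPositive (hA : A.IsPositive) (x y : H) :
    A.reApplyInnerSelf (x - y) = A.reApplyInnerSelf x - 2 * RCLike.re ⟪A x, y⟫_ℂ
      + A.reApplyInnerSelf y := by
  have h : RCLike.re ⟪A y, x⟫_ℂ = RCLike.re ⟪A x, y⟫_ℂ := by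
    rw [hA.inner_left_eq_inner_right, inner_re_symm]
  simp only [ContinuousLinearMap.reApplyInnerSelf_apply, map_sub, inner_sub_left,
    inner_sub_right, h]
  ring

/-- A positive contraction satisfies `A ^ 2 ≤ A`. -/
theorem norm_sq_apply_le_reApplyInnerSelf (hA : A.IsPositive)
    (hle : ∀ x, A.reApplyInnerSelf x ≤ ‖x‖ ^ 2) (x : H) :
    ‖A x‖ ^ 2 ≤ A.reApplyInnerSelf x := by
  have h := reApplyInnerSelf_sub_of_isPositive hA x (A x)
  rw [inner_self_eq_norm_sq] at h
  have h1 : 0 ≤ A.reApplyInnerSelf (x - A x) := hA.re_inner_nonneg_left _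
  linarith [hle (A x)]

theorem norm_sq_one_sub_apply_le (hA : A.IsPositive) (hc : ‖A‖ ≤ 1) (x : H) :
    ‖x - A x‖ ^ 2 ≤ (1 - A).reApplyInnerSelf x := by
  have hpos : (1 - A).IsPositive := by
    refine ⟨ContinuousLinearMap.isPositive_one.isSymmetric.sub hA.isSymmetric, fun y => ?_⟩
    have := reApplyInnerSelf_one_sub A y
    have := reApplyInnerSelf_le_norm_sq hc y
    change 0 ≤ (1 - A).reApplyInnerSelf y
    linarith
  refine norm_sq_apply_le_reApplyInnerSelf hpos (fun y => ?_) x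
  have : 0 ≤ A.reApplyInnerSelf y := hA.re_inner_nonneg_left y
  linarith [reApplyInnerSelf_one_sub A y]

/-- The energy `⟪(1 - A) x, x⟫` decreases under `A`. -/
theorem reApplyInnerSelf_one_sub_apply_le (hA : A.IsPositive) (hc : ‖A‖ ≤ 1) (x : H) :
    (1 - A).reApplyInnerSelf (A x) ≤ (1 - A).reApplyInnerSelf x := by
  have h := reApplyInnerSelf_sub_of_isPositive hA x (A x)
  rw [inner_self_eq_norm_sq] at h
  have h1 : 0 ≤ A.reApplyInnerSelf (x - A x) := hA.re_inner_nonneg_left _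
  have h2 := reApplyInnerSelf_le_norm_sq hc (x - A x)
  have h3 : ‖x - A x‖ ^ 2 = ‖x‖ ^ 2 - 2 * A.reApplyInnerSelf x + ‖A x‖ ^ 2 := by
    rw [@norm_sub_sq ℂ, inner_re_symm, A.reApplyInnerSelf_apply]
  rw [reApplyInnerSelf_one_sub, reApplyInnerSelf_one_sub]
  linarith

end PositiveContraction

section AscProd

variable {H : Type*} [NormedAddCommGroup H] [InnerProductSpace ℂ H]

/-- `ascProd T k m = T k ∘ T (k + 1) ∘ ⋯ ∘ T (k + m - 1)`. -/
noncomputable def ascProd (T : ℕ → H →L[ℂ] H) : ℕ → ℕ → H →L[ℂ] H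
  | _, 0 => 1
  | k, m + 1 => T k ∘L ascProd T (k + 1) m

theorem ascProd_succ_right (T : ℕ → H →L[ℂ] H) (k m : ℕ) :
    ascProd T k (m + 1) = ascProd T k m ∘L T (k + m) := by
  induction m generalizing k with
  | zero => rfl
  | succ m ih =>
    rw [ascProd, ih (k + 1), ascProd, ContinuousLinearMap.comp_assoc]
    congr 3
    omega

theorem adjoint_ascProd [CompleteSpace H] {T : ℕ → H →L[ℂ] H} (hT : ∀ n, (T n).IsPositive)
    (n : ℕ) : ContinuousLinearMap.adjoint (ascProd T 0 (n + 1)) = prodSeq T id n := by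
  induction n with
  | zero =>
    rw [ascProd_succ_right, ContinuousLinearMap.adjoint_comp, (hT _).isSelfAdjoint.adjoint_eq]
    simp only [ascProd, prodSeq, id, ← ContinuousLinearMap.star_eq_adjoint, star_one]
    rfl
  | succ n ih =>
    rw [ascProd_succ_right, ContinuousLinearMap.adjoint_comp, ih, (hT _).isSelfAdjoint.adjoint_eq,
      zero_add]
    rfl

theorem norm_ascProd_le {T : ℕ → H →L[ℂ] H} (hc : ∀ n, ‖T n‖ ≤ 1) (k m : ℕ) :
    ‖ascProd T k m‖ ≤ 1 := by
  induction m generalizing k with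
  | zero => exact ContinuousLinearMap.norm_id_le
  | succ m ih =>
    exact (ContinuousLinearMap.opNorm_comp_le _ _).trans
      (mul_le_one₀ (hc k) (norm_nonneg _) (ih (k + 1)))

theorem mul_energy_ascProd_le {T : ℕ → H →L[ℂ] H} (hT : ∀ n, (T n).IsPositive)
    (hc : ∀ n, ‖T n‖ ≤ 1)
    (hdec : ∀ n x, (T (n + 1)).reApplyInnerSelf x ≤ (T n).reApplyInnerSelf x) (k m : ℕ) (x : H) :
    m * (1 - T k).reApplyInnerSelf (ascProd T k m x) + ‖ascProd T k m x‖ ^ 2 ≤ ‖x‖ ^ 2 := by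
  induction m generalizing k with
  | zero => simp [ascProd]
  | succ m ih =>
    set y := ascProd T (k + 1) m x
    have hk : ascProd T k (m + 1) x = T k y := rfl
    have h1 := ih (k + 1)
    have h2 : (1 - T k).reApplyInnerSelf y ≤ (1 - T (k + 1)).reApplyInnerSelf y := by
      rw [reApplyInnerSelf_one_sub, reApplyInnerSelf_one_sub]
      linarith [hdec k y]
    have h3 := reApplyInnerSelf_one_sub_apply_le (hT k) (hc k) y
    have h4 := norm_sq_apply_le_reApplyInnerSelf (hT k) (reApplyInnerSelf_le_norm_sq (hc k)) y
    have h5 := reApplyInnerSelf_one_sub (T k) y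
    have h6 := mul_le_mul_of_nonneg_left (h3.trans h2) (Nat.cast_nonneg (α := ℝ) m)
    rw [hk]
    push_cast
    linarith

theorem norm_one_sub_comp_ascProd_le {T : ℕ → H →L[ℂ] H} (hT : ∀ n, (T n).IsPositive)
    (hc : ∀ n, ‖T n‖ ≤ 1)
    (hdec : ∀ n x, (T (n + 1)).reApplyInnerSelf x ≤ (T n).reApplyInnerSelf x)
    {j k : ℕ} (hjk : j ≤ k) (m : ℕ) :
    ‖(1 - T j) ∘L ascProd T k (m + 1)‖ ≤ √(1 / (m + 1)) := by
  refine ContinuousLinearMap.opNorm_le_bound _ (Real.sqrt_nonneg _) fun x => ?_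
  set y := ascProd T k (m + 1) x
  have h1 := mul_energy_ascProd_le hT hc hdec k (m + 1) x
  have h2 : (1 - T j).reApplyInnerSelf y ≤ (1 - T k).reApplyInnerSelf y := by
    rw [reApplyInnerSelf_one_sub, reApplyInnerSelf_one_sub]
    linarith [antitone_nat_of_succ_le (f := fun n => (T n).reApplyInnerSelf y)
      (fun n => hdec n y) hjk]
  have h3 := norm_sq_one_sub_apply_le (hT j) (hc j) y
  have h4 : ‖y - T j y‖ ^ 2 ≤ 1 / (m + 1) * ‖x‖ ^ 2 := by
    rw [one_div_mul_eq_div, le_div_iff₀' (by positivity)]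
    push_cast at h1
    nlinarith [sq_nonneg ‖y‖, mul_le_mul_of_nonneg_left (h3.trans h2)
      (by positivity : (0 : ℝ) ≤ m + 1)]
  calc ‖y - T j y‖ ≤ √(1 / (m + 1) * ‖x‖ ^ 2) := Real.le_sqrt_of_sq_le h4
    _ = √(1 / (m + 1)) * ‖x‖ := by
      rw [Real.sqrt_mul (by positivity), Real.sqrt_sq (norm_nonneg x)]

theorem tendsto_norm_one_sub_comp_ascProd {T : ℕ → H →L[ℂ] H} (hT : ∀ n, (T n).IsPositive)
    (hc : ∀ n, ‖T n‖ ≤ 1)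
    (hdec : ∀ n x, (T (n + 1)).reApplyInnerSelf x ≤ (T n).reApplyInnerSelf x) (d j : ℕ) :
    Tendsto (fun m => (1 - T (j + d)) ∘L ascProd T j m) atTop (𝓝 0) := by
  have hsqrt : Tendsto (fun m : ℕ => √(1 / ((m : ℝ) + 1))) atTop (𝓝 0) := by
    simpa using tendsto_one_div_add_atTop_nhds_zero_nat.sqrt
  have hstep (i k : ℕ) (h : i ≤ k) :
      Tendsto (fun m => (1 - T i) ∘L ascProd T k m) atTop (𝓝 0) :=
    (tendsto_add_atTop_iff_nat 1).mp <| squeeze_zero_norm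
      (fun m => norm_one_sub_comp_ascProd_le hT hc hdec h m) hsqrt
  induction d generalizing j with
  | zero => exact hstep j j le_rfl
  | succ d ih =>
    rw [← tendsto_add_atTop_iff_nat 1]
    have h1 := ih (j + 1)
    have h2 := (hstep j (j + 1) j.le_succ).const_mul (1 - T (j + 1 + d))
    rw [mul_zero] at h2
    have h3 := h1.sub h2
    rw [sub_zero] at h3
    refine h3.congr fun m => ?_
    rw [ascProd, show j + (d + 1) = j + 1 + d by omega]
    ext x
    simp only [ContinuousLinearMap.comp_apply, sub_apply, mul_apply_eq_comp,
      one_apply_eq_self, map_sub]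
    abel

theorem tendsto_prodSeq_comp_one_sub [CompleteSpace H] {T : ℕ → H →L[ℂ] H}
    (hT : ∀ n, (T n).IsPositive) (hc : ∀ n, ‖T n‖ ≤ 1)
    (hdec : ∀ n x, (T (n + 1)).reApplyInnerSelf x ≤ (T n).reApplyInnerSelf x) (k : ℕ) :
    Tendsto (fun n => prodSeq T id n ∘L (1 - T k)) atTop (𝓝 0) := by
  have h := (tendsto_norm_one_sub_comp_ascProd hT hc hdec k 0).norm
  rw [← tendsto_add_atTop_iff_nat 1, norm_zero, zero_add] at h
  rw [tendsto_zero_iff_norm_tendsto_zero]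
  refine h.congr fun n => ?_
  rw [← LinearIsometryEquiv.norm_map ContinuousLinearMap.adjoint,
    ContinuousLinearMap.adjoint_comp, adjoint_ascProd hT, map_sub, (hT k).isSelfAdjoint.adjoint_eq,
    ← ContinuousLinearMap.star_eq_adjoint 1, star_one]

theorem norm_prodSeq_le {T : ℕ → H →L[ℂ] H} (hc : ∀ n, ‖T n‖ ≤ 1) (n : ℕ) :
    ‖prodSeq T id n‖ ≤ 1 := by
  induction n with
  | zero => exact hc 0
  | succ n ih =>
    exact (ContinuousLinearMap.opNorm_comp_le _ _).trans
      (mul_le_one₀ (hc (n + 1)) (norm_nonneg _) ih)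

theorem prodSeq_apply_eq_self {T : ℕ → H →L[ℂ] H} {x : H} (hx : ∀ n, T n x = x) (n : ℕ) :
    prodSeq T id n x = x := by
  induction n with
  | zero => exact hx 0
  | succ n ih =>
    rw [prodSeq, ContinuousLinearMap.comp_apply, ih]
    exact hx (n + 1)

end AscProd

theorem isClosed_setOf_tendsto_zero_of_norm_le_one {H : Type*} [NormedAddCommGroup H]
    [InnerProductSpace ℂ H] {S : ℕ → H →L[ℂ] H} (hS : ∀ n, ‖S n‖ ≤ 1) :
    IsClosed {x | Tendsto (fun n => S n x) atTop (𝓝 0)} := by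
  refine isClosed_of_closure_subset fun x hx => ?_
  rw [Set.mem_ofPred_eq, Metric.tendsto_atTop]
  intro ε hε
  obtain ⟨y, hy, hxy⟩ := Metric.mem_closure_iff.mp hx (ε / 2) (half_pos hε)
  obtain ⟨N, hN⟩ := Metric.tendsto_atTop.mp hy (ε / 2) (half_pos hε)
  refine ⟨N, fun n hn => ?_⟩
  have h1 := hN n hn
  have h2 : ‖S n (x - y)‖ ≤ ‖x - y‖ := by simpa using (S n).le_of_opNorm_le (hS n) (x - y)
  rw [dist_zero_right] at h1 ⊢
  rw [dist_eq_norm] at hxy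
  have h3 : S n x = S n (x - y) + S n y := by simp
  rw [h3]
  exact (norm_add_le _ _).trans_lt (by linarith)

/-- Strong Paszkiewicz conjecture: `S n ξ → P ξ`, where `P` is the orthogonal projection
onto the fixed-point space of the strong operator limit `Tlim` of the `T n`. -/
theorem paszkiewicz_conjecture_strong
    {H : Type*} [NormedAddCommGroup H] [InnerProductSpace ℂ H] [CompleteSpace H]
    (T : ℕ → H →L[ℂ] H)
    (hpos : ∀ n, ∀ ξ : H, 0 ≤ ⟪(T n) ξ, ξ⟫_ℂ)
    (hcontr : ∀ n, ‖T n‖ ≤ 1)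
    (hdec : ∀ n, ∀ ξ : H, ⟪(T (n + 1)) ξ, ξ⟫_ℂ ≤ ⟪(T n) ξ, ξ⟫_ℂ)
    (Tlim : H →L[ℂ] H)
    (hTlim : ∀ ξ : H, Tendsto (fun n => (T n) ξ) atTop (𝓝 (Tlim ξ)))
    (P : H →L[ℂ] H)
    (hPmem : ∀ ξ : H, Tlim (P ξ) = P ξ)
    (hPorth : ∀ ξ η : H, Tlim η = η → ⟪ξ - P ξ, η⟫_ℂ = 0) :
    ∀ ξ : H, Tendsto (fun n => prodSeq T id n ξ) atTop (𝓝 (P ξ)) := by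
  have hT : ∀ n, (T n).IsPositive := fun n => by
    refine (ContinuousLinearMap.isPositive_toLinearMap_iff _).mp
      ((LinearMap.isPositive_iff_complex _).mpr fun x => ?_)
    obtain ⟨h1, h2⟩ := Complex.le_def.mp (hpos n x)
    exact ⟨Complex.ext rfl h2, h1⟩
  have hre : ∀ n x, (T (n + 1)).reApplyInnerSelf x ≤ (T n).reApplyInnerSelf x :=
    fun n x => (Complex.le_def.mp (hdec n x)).1
  have hsymm : Tlim.IsSymmetric := fun x y =>
    tendsto_nhds_unique ((hTlim x).inner tendsto_const_nhds)
      ((tendsto_const_nhds.inner (hTlim y)).congr fun n =>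
        ((hT n).inner_left_eq_inner_right x y).symm)
  have hfix : ∀ x, Tlim x = x → ∀ n, T n x = x := fun x hx n => by
    have hlim : Tendsto (fun m => (T m).reApplyInnerSelf x) atTop (𝓝 (‖x‖ ^ 2)) := by
      have := (RCLike.continuous_re.tendsto _).comp ((hTlim x).inner (𝕜 := ℂ)
        (tendsto_const_nhds (x := x)))
      rwa [hx, inner_self_eq_norm_sq] at this
    have h1 : ‖x‖ ^ 2 ≤ (T n).reApplyInnerSelf x :=
      (antitone_nat_of_succ_le fun m => hre m x).le_of_tendsto hlim n
    have h2 := norm_sq_one_sub_apply_le (hT n) (hcontr n) x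
    rw [reApplyInnerSelf_one_sub] at h2
    have h3 : ‖x - T n x‖ = 0 := by nlinarith [norm_nonneg (x - T n x)]
    exact (sub_eq_zero.mp (norm_eq_zero.mp h3)).symm
  have hrange : ∀ y, Tendsto (fun n => prodSeq T id n (y - Tlim y)) atTop (𝓝 0) := fun y => by
    rw [Metric.tendsto_atTop]
    intro ε hε
    obtain ⟨k, hk⟩ := (Metric.tendsto_atTop.mp (hTlim y)) (ε / 2) (half_pos hε)
    have hcomp : Tendsto (fun n => prodSeq T id n (y - T k y)) atTop (𝓝 0) := by
      simpa [Function.comp_def] using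
        ((ContinuousLinearMap.apply ℂ H y).continuous.tendsto _).comp
          (tendsto_prodSeq_comp_one_sub hT hcontr hre k)
    obtain ⟨N, hN⟩ := Metric.tendsto_atTop.mp hcomp (ε / 2) (half_pos hε)
    refine ⟨N, fun n hn => ?_⟩
    have h1 := hN n hn
    have h2 := hk k le_rfl
    have h3 : ‖prodSeq T id n (T k y - Tlim y)‖ ≤ ‖T k y - Tlim y‖ := by
      simpa using (prodSeq T id n).le_of_opNorm_le (norm_prodSeq_le hcontr n) (T k y - Tlim y)
    rw [dist_zero_right] at h1 ⊢
    rw [dist_eq_norm] at h2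
    rw [← sub_add_sub_cancel y (T k y) (Tlim y), map_add]
    exact (norm_add_le _ _).trans_lt (by linarith)
  intro ξ
  have hadj : ContinuousLinearMap.adjoint (1 - Tlim) = 1 - Tlim :=
    ((IsSelfAdjoint.one _).sub
      (ContinuousLinearMap.isSelfAdjoint_iff_isSymmetric.mpr hsymm)).adjoint_eq
  have hmem : ξ - P ξ ∈ closure ((1 - Tlim).range : Set H) := by
    rw [← Submodule.topologicalClosure_coe, ← hadj, ← ContinuousLinearMap.orthogonal_ker,
      SetLike.mem_coe, Submodule.mem_orthogonal']
    intro η hη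
    refine hPorth ξ η (sub_eq_zero.mp ?_).symm
    simpa using hη
  have hzero : Tendsto (fun n => prodSeq T id n (ξ - P ξ)) atTop (𝓝 0) := by
    refine closure_minimal ?_
      (isClosed_setOf_tendsto_zero_of_norm_le_one (norm_prodSeq_le hcontr)) hmem
    rintro _ ⟨y, rfl⟩
    exact hrange y
  have h := hzero.add_const (P ξ)
  rw [zero_add] at h
  refine h.congr fun n => ?_
  rw [map_sub, prodSeq_apply_eq_self (hfix _ (hPmem ξ)) n, sub_add_cancel]
end

section
/- For every real δ with 0 < δ < 1 there exist n ∈ ℕ and positive linear contractions T_1, …, T_n on the 2-dimensional real Hilbert space ℝ² such that I ≥ T_1 ≥ T_2 ≥ ⋯ ≥ T_n ≥ (1−δ)I and T_n T_{n-1} ⋯ T_1 maps the vector (1, 0) to the vector (0, 1−δ). -/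
open scoped InnerProductSpace

/-- The vector `(a, b)` in the Euclidean plane. -/
noncomputable def vec2 (a b : ℝ) : EuclideanSpace ℝ (Fin 2) :=
  (WithLp.equiv 2 (Fin 2 → ℝ)).symm ![a, b]

section Reachability

variable {E : Type*} [NormedAddCommGroup E] [InnerProductSpace ℝ E]

/-- `w` is the image of `v` under a product of a decreasing chain of operators lying between `B`
and the identity. The list starts with the smallest operator, which is applied last. -/
def ReachableAbove (B : E →L[ℝ] E) (v w : E) : Prop :=
  ∃ L : List (E →L[ℝ] E), L.Pairwise (· ≤ ·) ∧ (∀ T ∈ L, B ≤ T ∧ T ≤ 1) ∧ L.prod v = w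

theorem ReachableAbove.mono {B S : E →L[ℝ] E} {v w : E} (h : ReachableAbove B v w) (hS : S ≤ B) :
    ReachableAbove S v w := by
  obtain ⟨L, hL, hB, hw⟩ := h
  exact ⟨L, hL, fun T hT => ⟨hS.trans (hB T hT).1, (hB T hT).2⟩, hw⟩

theorem ReachableAbove.apply {B S : E →L[ℝ] E} {v w : E} (h : ReachableAbove B v w) (hS : S ≤ B)
    (hS1 : S ≤ 1) : ReachableAbove S v (S w) := by
  obtain ⟨L, hL, hB, hw⟩ := h
  refine ⟨S :: L, List.pairwise_cons.2 ⟨fun T hT => hS.trans (hB T hT).1, hL⟩, ?_, by simp [hw]⟩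
  intro T hT
  rcases List.mem_cons.1 hT with rfl | hT
  · exact ⟨le_rfl, hS1⟩
  · exact ⟨hS.trans (hB T hT).1, (hB T hT).2⟩

theorem ReachableAbove.pow_apply {B S : E →L[ℝ] E} {v w : E} (h : ReachableAbove B v w)
    (hS : S ≤ B) (hS1 : S ≤ 1) (m : ℕ) : ReachableAbove S v ((S ^ m) w) := by
  induction m with
  | zero => simpa using h.mono hS
  | succ m ih => simpa [pow_succ'] using ih.apply le_rfl hS1

/-- `w` can be approximated by images of `v` under products of decreasing chains of operators
that are arbitrarily close to the identity. -/
def AlmostReachable (v w : E) : Prop :=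
  ∀ ε : ℝ, 0 < ε → ε < 1 → ∃ x, ‖x - w‖ ≤ ε ∧ ReachableAbove ((1 - ε) • (1 : E →L[ℝ] E)) v x

theorem AlmostReachable.refl (v : E) : AlmostReachable v v :=
  fun ε hε _ => ⟨v, by simpa using hε.le, [], by simp, by simp, by simp⟩

theorem smul_one_le_smul_one {a b : ℝ} (h : a ≤ b) :
    a • (1 : E →L[ℝ] E) ≤ b • (1 : E →L[ℝ] E) := by
  rw [ContinuousLinearMap.le_def, ← sub_smul]
  exact ContinuousLinearMap.isPositive_one.smul_of_nonneg (sub_nonneg.2 h)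

theorem rankOne_self_le_one {u : E} (hu : ‖u‖ = 1) : InnerProductSpace.rankOne ℝ u u ≤ 1 := by
  rw [ContinuousLinearMap.le_def, ContinuousLinearMap.isPositive_def]
  refine ⟨LinearMap.IsSymmetric.sub LinearMap.IsSymmetric.id
    (InnerProductSpace.isPositive_rankOne_self u).isSymmetric, fun x => ?_⟩
  have h := abs_real_inner_le_norm u x
  rw [hu, one_mul] at h
  have h2 := sq_le_sq' (neg_le_of_abs_le h) (le_of_abs_le h)
  simp only [ContinuousLinearMap.reApplyInnerSelf_apply, sub_apply,
    one_apply_eq_self, InnerProductSpace.rankOne_apply, inner_sub_left,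
    real_inner_smul_left, real_inner_self_eq_norm_sq, RCLike.re_to_real]
  nlinarith

/-- Powers of the operator with eigenvalue `b` on the line through `u` and `a` on its complement. -/
theorem smul_one_add_smul_rankOne_pow_apply {u : E} (hu : ‖u‖ = 1) (a b : ℝ) (m : ℕ) (x : E) :
    ((a • (1 : E →L[ℝ] E) + (b - a) • InnerProductSpace.rankOne ℝ u u) ^ m) x =
      a ^ m • x + (b ^ m - a ^ m) • ⟪u, x⟫_ℝ • u := by
  induction m with
  | zero => simp
  | succ m ih =>
    rw [pow_succ', mul_apply_eq_comp, ih]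
    simp only [add_apply, smul_apply,
      one_apply_eq_self, InnerProductSpace.rankOne_apply, inner_add_right,
      real_inner_smul_right, real_inner_self_eq_norm_sq, hu]
    module

theorem AlmostReachable.project {v w u : E} (h : AlmostReachable v w) (hw : ‖w‖ ≤ 1)
    (hu : ‖u‖ = 1) : AlmostReachable v (⟪u, w⟫_ℝ • u) := by
  intro ε hε hε1
  obtain ⟨m, hm⟩ := exists_pow_lt_of_lt_one (show 0 < ε / 8 by positivity)
    (show 1 - ε < 1 by linarith)
  set e : ℝ := ε / (8 * (m + 1)) with he
  have hm0 : (0 : ℝ) ≤ m := m.cast_nonneg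
  have he0 : 0 < e := by positivity
  have hem : e * (m + 1) = ε / 8 := by rw [he]; field_simp
  have he8 : e ≤ ε / 8 := by nlinarith
  obtain ⟨x, hx, hr⟩ := h e he0 (by linarith)
  have hle : (1 - ε) • (1 : E →L[ℝ] E) +
      ((1 - e) - (1 - ε)) • InnerProductSpace.rankOne ℝ u u ≤ (1 - e) • (1 : E →L[ℝ] E) := by
    have := (ContinuousLinearMap.le_def _ _).1 (rankOne_self_le_one hu)
    rw [ContinuousLinearMap.le_def]
    convert this.smul_of_nonneg (c := (1 - e) - (1 - ε)) (by linarith) using 1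
    module
  have hge : (1 - ε) • (1 : E →L[ℝ] E) ≤ (1 - ε) • (1 : E →L[ℝ] E) +
      ((1 - e) - (1 - ε)) • InnerProductSpace.rankOne ℝ u u := by
    rw [ContinuousLinearMap.le_def, add_sub_cancel_left]
    exact (InnerProductSpace.isPositive_rankOne_self u).smul_of_nonneg (by linarith)
  have hone : (1 - e) • (1 : E →L[ℝ] E) ≤ 1 := by
    simpa using smul_one_le_smul_one (E := E) (show 1 - e ≤ 1 by linarith)
  refine ⟨_, ?_, (hr.pow_apply hle (hle.trans hone) m).mono hge⟩
  rw [smul_one_add_smul_rankOne_pow_apply hu]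
  have hα0 : 0 ≤ (1 - ε) ^ m := pow_nonneg (by linarith) m
  have hβ1 : (1 - e) ^ m ≤ 1 := pow_le_one₀ (by linarith) (by linarith)
  have hαβ : (1 - ε) ^ m ≤ (1 - e) ^ m := pow_le_pow_left₀ (by linarith) (by linarith) m
  have hβ : 1 - ε / 8 ≤ (1 - e) ^ m := by
    have := one_add_mul_le_pow (show (-2 : ℝ) ≤ -e by linarith) m
    rw [← sub_eq_add_neg] at this
    nlinarith
  set α := (1 - ε) ^ m
  set β := (1 - e) ^ m
  have hproj (z : E) : ‖⟪u, z⟫_ℝ • u‖ ≤ ‖z‖ := by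
    rw [norm_smul, hu, mul_one]
    simpa [hu] using abs_real_inner_le_norm u z
  have hsplit : α • x + (β - α) • ⟪u, x⟫_ℝ • u - ⟪u, w⟫_ℝ • u =
      (α • (x - w) + (β - α) • ⟪u, x - w⟫_ℝ • u) + (α • w - (1 - β + α) • ⟪u, w⟫_ℝ • u) := by
    rw [inner_sub_right]; module
  rw [hsplit]
  have h1 : ‖α • (x - w) + (β - α) • ⟪u, x - w⟫_ℝ • u‖ ≤ α * e + (β - α) * e := by
    refine (norm_add_le _ _).trans ?_
    rw [norm_smul, norm_smul (β - α), Real.norm_of_nonneg hα0,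
      Real.norm_of_nonneg (sub_nonneg.2 hαβ)]
    have := (hproj (x - w)).trans hx
    have := sub_nonneg.2 hαβ
    gcongr
  have h2 : ‖α • w - (1 - β + α) • ⟪u, w⟫_ℝ • u‖ ≤ α * 1 + (1 - β + α) * 1 := by
    have h3 : 0 ≤ 1 - β + α := by linarith
    refine (norm_sub_le _ _).trans ?_
    rw [norm_smul, norm_smul (1 - β + α), Real.norm_of_nonneg hα0, Real.norm_of_nonneg h3]
    have := (hproj w).trans hw
    gcongr
  refine (norm_add_le _ _).trans ?_
  nlinarith

theorem ReachableAbove.exists_fin {v w : E} {B S : E →L[ℝ] E} (h : ReachableAbove B v w)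
    (hS : S ≤ B) (hS1 : S ≤ 1) :
    ∃ n : ℕ, ∃ T : Fin (n + 1) → (E →L[ℝ] E), (∀ i j, i ≤ j → T j ≤ T i) ∧ (∀ i, T i ≤ 1) ∧
      T (Fin.last n) = S ∧ (List.ofFn T).reverse.prod v = S w := by
  obtain ⟨L, hL, hB, hw⟩ := h
  have hP : (S :: L).Pairwise (· ≤ ·) :=
    List.pairwise_cons.2 ⟨fun T hT => hS.trans (hB T hT).1, hL⟩
  refine ⟨L.length, fun i => (S :: L).get i.rev, ?_, ?_, ?_, ?_⟩
  · intro i j hij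
    exact hP.rel_get_of_le (Fin.rev_le_rev.2 hij)
  · intro i
    rcases List.mem_cons.1 ((S :: L).get_mem i.rev) with h | h
    · exact h.le.trans hS1
    · exact (hB _ h).2
  · simp
  · have : (List.ofFn fun i : Fin (L.length + 1) => (S :: L).get i.rev).reverse = S :: L := by
      refine List.ext_getElem (by simp) fun i h1 h2 => ?_
      simp only [List.length_cons] at h2
      simp only [List.getElem_reverse, List.getElem_ofFn, List.length_ofFn, List.get_eq_getElem,
        Fin.val_rev]
      congr 1
      simp only [List.length_cons]
      omega
    rw [this]
    simp [hw]

end Reachability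

section Plane

/-- The operator on the plane with matrix `!![p, q; q, s]`. -/
noncomputable def symmPlane (p q s : ℝ) : EuclideanSpace ℝ (Fin 2) →L[ℝ] EuclideanSpace ℝ (Fin 2) :=
  Matrix.toEuclideanCLM (𝕜 := ℝ) !![p, q; q, s]

theorem symmPlane_apply_zero (p q s : ℝ) (x : EuclideanSpace ℝ (Fin 2)) :
    symmPlane p q s x 0 = p * x 0 + q * x 1 := by
  simp [symmPlane, Matrix.ofLp_toEuclideanCLM, Matrix.mulVec, dotProduct, Fin.sum_univ_two]

theorem symmPlane_apply_one (p q s : ℝ) (x : EuclideanSpace ℝ (Fin 2)) :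
    symmPlane p q s x 1 = q * x 0 + s * x 1 := by
  simp [symmPlane, Matrix.ofLp_toEuclideanCLM, Matrix.mulVec, dotProduct, Fin.sum_univ_two]

theorem isPositive_symmPlane {p q s : ℝ} (hp : 0 < p) (h : q ^ 2 ≤ p * s) :
    (symmPlane p q s).IsPositive := by
  rw [ContinuousLinearMap.isPositive_def]
  refine ⟨fun x y => ?_, fun x => ?_⟩
  · simp only [ContinuousLinearMap.coe_coe, PiLp.inner_apply, Fin.sum_univ_two,
      symmPlane_apply_zero, symmPlane_apply_one, RCLike.inner_apply, conj_trivial]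
    ring
  · simp only [ContinuousLinearMap.reApplyInnerSelf_apply, PiLp.inner_apply, Fin.sum_univ_two,
      symmPlane_apply_zero, symmPlane_apply_one, RCLike.inner_apply, conj_trivial,
      RCLike.re_to_real]
    refine nonneg_of_mul_nonneg_right (a := p) ?_ hp
    nlinarith [sq_nonneg (p * x 0 + q * x 1), mul_nonneg (sub_nonneg.2 h) (sq_nonneg (x 1))]

theorem symmPlane_le_smul_one {p q s c : ℝ} (hp : p < c) (h : q ^ 2 ≤ (c - p) * (c - s)) :
    symmPlane p q s ≤ c • (1 : EuclideanSpace ℝ (Fin 2) →L[ℝ] EuclideanSpace ℝ (Fin 2)) := by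
  rw [ContinuousLinearMap.le_def]
  convert isPositive_symmPlane (p := c - p) (q := -q) (s := c - s) (by linarith)
    (by simpa using h) using 1
  ext x i
  fin_cases i <;> simp [symmPlane_apply_zero, symmPlane_apply_one] <;> ring

theorem smul_one_le_symmPlane {p q s d : ℝ} (hp : d < p) (h : q ^ 2 ≤ (p - d) * (s - d)) :
    d • (1 : EuclideanSpace ℝ (Fin 2) →L[ℝ] EuclideanSpace ℝ (Fin 2)) ≤ symmPlane p q s := by
  rw [ContinuousLinearMap.le_def]
  convert isPositive_symmPlane (p := p - d) (q := q) (s := s - d) (by linarith) h using 1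
  ext x i
  fin_cases i <;> simp [symmPlane_apply_zero, symmPlane_apply_one] <;> ring

@[simp] theorem vec2_zero (a b : ℝ) : vec2 a b 0 = a := rfl

@[simp] theorem vec2_one (a b : ℝ) : vec2 a b 1 = b := rfl

theorem norm_vec2_cos_sin (θ : ℝ) : ‖vec2 (Real.cos θ) (Real.sin θ)‖ = 1 := by
  simp [EuclideanSpace.norm_eq, Fin.sum_univ_two]

theorem inner_vec2_cos_sin (θ φ : ℝ) :
    ⟪vec2 (Real.cos θ) (Real.sin θ), vec2 (Real.cos φ) (Real.sin φ)⟫_ℝ = Real.cos (θ - φ) := by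
  simp only [PiLp.inner_apply, Fin.sum_univ_two, vec2_zero, vec2_one, RCLike.inner_apply,
    conj_trivial, Real.cos_sub]
  ring

theorem almostReachable_cos_pow_smul (η : ℝ) (k : ℕ) :
    AlmostReachable (vec2 1 0)
      (Real.cos η ^ k • vec2 (Real.cos (k * η)) (Real.sin (k * η))) := by
  induction k with
  | zero => simpa using AlmostReachable.refl (vec2 1 0)
  | succ k ih =>
    have h := ih.project ?_ (norm_vec2_cos_sin ((k + 1 : ℕ) * η))
    · rw [real_inner_smul_right, inner_vec2_cos_sin] at h
      convert h using 2
      rw [pow_succ]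
      push_cast
      ring_nf
    · rw [norm_smul, norm_vec2_cos_sin, mul_one, norm_pow]
      exact pow_le_one₀ (norm_nonneg _) (Real.abs_cos_le_one η)

theorem exists_almostReachable_vec2_zero {κ : ℝ} (hκ : 0 < κ) :
    ∃ r : ℝ, 1 - κ ≤ r ∧ r ≤ 1 ∧ AlmostReachable (vec2 1 0) (vec2 0 r) := by
  obtain ⟨N, hN⟩ := exists_nat_gt (2 / κ)
  have hN0 : (0 : ℝ) < N := lt_trans (by positivity) hN
  set η : ℝ := Real.pi / (2 * N) with hη
  have hNη : N * η = Real.pi / 2 := by rw [hη]; field_simp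
  have h := almostReachable_cos_pow_smul η N
  rw [hNη, Real.cos_pi_div_two, Real.sin_pi_div_two] at h
  have hηsq : N * (η ^ 2 / 2) ≤ κ := by
    have hπ : Real.pi ^ 2 ≤ 16 := by nlinarith [Real.pi_le_four, Real.pi_pos]
    have h2 : N * (N * (η ^ 2 / 2)) ≤ 2 := by
      have : N * (N * (η ^ 2 / 2)) = (N * η) ^ 2 / 2 := by ring
      rw [this, hNη]
      linarith
    have h3 : 2 < N * κ := by rwa [div_lt_iff₀ hκ] at hN
    exact le_of_mul_le_mul_left (h2.trans h3.le) hN0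
  have hcos := Real.one_sub_sq_div_two_le_cos (x := η)
  refine ⟨Real.cos η ^ N, ?_, ?_, ?_⟩
  · have := one_add_mul_sub_le_pow (Real.neg_one_le_cos η) N
    nlinarith
  · exact (le_abs_self _).trans
      ((abs_pow _ _).le.trans (pow_le_one₀ (abs_nonneg _) (Real.abs_cos_le_one η)))
  · convert h using 1
    ext i
    fin_cases i <;> simp

/-- A vector `(a, b)` close enough to the second axis is mapped onto that axis by a symmetric
operator between `d` and `c`. -/
theorem exists_symmPlane_apply_eq {c d a b : ℝ} (hb : 0 < b) (hd : 0 < d) (hdc : d < c)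
    (hlow : ((c + d) / 2 * (a / b)) ^ 2 ≤ (c - d) / 2 * (d / b - d))
    (hup : ((c + d) / 2 * (a / b)) ^ 2 ≤
      (c - d) / 2 * (c - d / b - (c + d) / 2 * (a / b) ^ 2)) :
    ∃ S : EuclideanSpace ℝ (Fin 2) →L[ℝ] EuclideanSpace ℝ (Fin 2),
      d • (1 : EuclideanSpace ℝ (Fin 2) →L[ℝ] EuclideanSpace ℝ (Fin 2)) ≤ S ∧
      S ≤ c • (1 : EuclideanSpace ℝ (Fin 2) →L[ℝ] EuclideanSpace ℝ (Fin 2)) ∧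
      ∀ x : EuclideanSpace ℝ (Fin 2), x 0 = a → x 1 = b → S x = vec2 0 d := by
  refine ⟨symmPlane ((c + d) / 2) (-((c + d) / 2 * (a / b))) (d / b + (c + d) / 2 * (a / b) ^ 2),
    smul_one_le_symmPlane (by linarith) ?_, symmPlane_le_smul_one (by linarith) ?_, ?_⟩
  · have hcd : 0 ≤ (c - d) / 2 * ((c + d) / 2 * (a / b) ^ 2) := by
      have : 0 ≤ c + d := by linarith
      have : 0 ≤ c - d := by linarith
      positivity
    nlinarith
  · nlinarith
  · rintro x rfl rfl
    ext i
    fin_cases i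
    · simp only [Fin.zero_eta, symmPlane_apply_zero, vec2_zero]
      field_simp
      ring
    · simp only [Fin.mk_one, symmPlane_apply_one, vec2_one]
      field_simp
      ring

theorem exists_symmPlane_apply_eq_of_sq_le {δ a b : ℝ} (hδ0 : 0 < δ) (hδ1 : δ < 1) (hb0 : 0 < b)
    (hb1 : b ≤ 1 - δ / 5) (hcb : 1 - δ + 3 * δ / 8 ≤ (1 - δ / 4) * b)
    (ht : (a / b) ^ 2 ≤ (1 - δ) ^ 2 * δ ^ 2 / 100) :
    ∃ S : EuclideanSpace ℝ (Fin 2) →L[ℝ] EuclideanSpace ℝ (Fin 2),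
      (1 - δ) • (1 : EuclideanSpace ℝ (Fin 2) →L[ℝ] EuclideanSpace ℝ (Fin 2)) ≤ S ∧
      S ≤ (1 - δ / 4) • (1 : EuclideanSpace ℝ (Fin 2) →L[ℝ] EuclideanSpace ℝ (Fin 2)) ∧
      ∀ x : EuclideanSpace ℝ (Fin 2), x 0 = a → x 1 = b → S x = vec2 0 (1 - δ) := by
  have hd0 : 0 < 1 - δ := by linarith
  set t := a / b
  have hlow : (1 - δ) * δ / 5 ≤ (1 - δ) / b - (1 - δ) := by
    rw [le_sub_iff_add_le, le_div_iff₀ hb0]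
    have : (1 + δ / 5) * b ≤ 1 := by nlinarith
    nlinarith
  have hup : 3 * δ / 8 ≤ (1 - δ / 4) - (1 - δ) / b := by
    rw [le_sub_comm, div_le_iff₀ hb0]
    nlinarith
  have hεd : (1 - δ) ^ 2 * δ ^ 2 / 100 ≤ (1 - δ) * δ ^ 2 / 100 := by
    nlinarith [mul_pos hd0 (sq_pos_of_pos hδ0)]
  have hεδ2 : (1 - δ) ^ 2 * δ ^ 2 / 100 ≤ δ ^ 2 / 100 := by
    nlinarith [mul_pos hd0 (sq_pos_of_pos hδ0)]
  have hp0 : 0 ≤ ((1 - δ / 4) + (1 - δ)) / 2 := by linarith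
  have hp1 : ((1 - δ / 4) + (1 - δ)) / 2 ≤ 1 := by linarith
  have hpt : (((1 - δ / 4) + (1 - δ)) / 2 * t) ^ 2 ≤ (1 - δ) ^ 2 * δ ^ 2 / 100 := by
    rw [mul_pow]
    exact (mul_le_of_le_one_left (sq_nonneg t) (pow_le_one₀ hp0 hp1)).trans ht
  have hpt2 : ((1 - δ / 4) + (1 - δ)) / 2 * t ^ 2 ≤ (1 - δ) ^ 2 * δ ^ 2 / 100 :=
    (mul_le_of_le_one_left (sq_nonneg t) hp1).trans ht
  have hgap : ((1 - δ / 4) - (1 - δ)) / 2 = 3 * δ / 8 := by ring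
  obtain ⟨S, hS, hS', hSx⟩ := exists_symmPlane_apply_eq (a := a) hb0 hd0
    (show 1 - δ < 1 - δ / 4 by linarith)
    (by
      rw [hgap]
      refine (hpt.trans hεd).trans (le_trans ?_ (mul_le_mul_of_nonneg_left hlow (by positivity)))
      nlinarith [mul_pos hd0 (sq_pos_of_pos hδ0)])
    (by
      rw [hgap]
      refine (hpt.trans hεδ2).trans ?_
      have : δ / 8 ≤ 1 - δ / 4 - (1 - δ) / b - (1 - δ / 4 + (1 - δ)) / 2 * t ^ 2 := by
        have : δ ^ 2 ≤ δ := by nlinarith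
        linarith
      have := mul_le_mul_of_nonneg_left this (show 0 ≤ 3 * δ / 8 by positivity)
      linarith [sq_nonneg δ])
  exact ⟨S, hS, hS', hSx⟩

theorem exists_symmPlane_apply_smul_eq {δ r : ℝ} (hδ0 : 0 < δ) (hδ1 : δ < 1)
    (hr : 1 - δ / 16 ≤ r) (hr1 : r ≤ 1) {x : EuclideanSpace ℝ (Fin 2)}
    (hx : ‖x - vec2 0 r‖ ≤ (1 - δ) * δ / 20) :
    ∃ S : EuclideanSpace ℝ (Fin 2) →L[ℝ] EuclideanSpace ℝ (Fin 2),
      (1 - δ) • (1 : EuclideanSpace ℝ (Fin 2) →L[ℝ] EuclideanSpace ℝ (Fin 2)) ≤ S ∧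
      S ≤ (1 - δ / 4) • (1 : EuclideanSpace ℝ (Fin 2) →L[ℝ] EuclideanSpace ℝ (Fin 2)) ∧
      S ((1 - δ / 4) • x) = vec2 0 (1 - δ) := by
  set ε : ℝ := (1 - δ) * δ / 20 with hε
  have hd0 : 0 < 1 - δ := by linarith
  have hε0 : 0 < ε := by positivity
  have hεδ : ε ≤ δ / 20 := by nlinarith
  have h0 : |x 0| ≤ ε := by
    simpa using (PiLp.norm_apply_le (x - vec2 0 r) 0).trans hx
  have h1 : |x 1 - r| ≤ ε := by
    simpa using (PiLp.norm_apply_le (x - vec2 0 r) 1).trans hx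
  obtain ⟨h1l, h1u⟩ := abs_le.1 h1
  have hx1 : 1 / 2 ≤ x 1 := by linarith
  have hc0 : 0 < 1 - δ / 4 := by linarith
  have hb0 : 0 < (1 - δ / 4) * x 1 := by nlinarith
  have hb1 : (1 - δ / 4) * x 1 ≤ 1 - δ / 5 := by nlinarith
  have ht : ((1 - δ / 4) * x 0 / ((1 - δ / 4) * x 1)) ^ 2 ≤ (1 - δ) ^ 2 * δ ^ 2 / 100 := by
    have hε2 : 4 * ε ^ 2 = (1 - δ) ^ 2 * δ ^ 2 / 100 := by rw [hε]; ring
    rw [← hε2]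
    rw [mul_div_mul_left _ _ hc0.ne', div_pow, div_le_iff₀ (by positivity)]
    have hsq : x 0 ^ 2 ≤ ε ^ 2 := sq_le_sq' (abs_le.1 h0).1 (abs_le.1 h0).2
    have : 1 / 4 ≤ x 1 ^ 2 := by nlinarith
    nlinarith [sq_nonneg ε]
  have hcb : 1 - δ + 3 * δ / 8 ≤ (1 - δ / 4) * ((1 - δ / 4) * x 1) := by
    have h2 : 1 - δ / 2 ≤ (1 - δ / 4) * (1 - δ / 4) := by nlinarith
    have h3 : 1 - δ / 8 ≤ x 1 := by linarith
    nlinarith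
  obtain ⟨S, hS, hS', hSx⟩ := exists_symmPlane_apply_eq_of_sq_le hδ0 hδ1 hb0 hb1 hcb ht
  exact ⟨S, hS, hS', hSx _ (by simp) (by simp)⟩

end Plane

/-- For every `0 < δ < 1` there are finitely many positive contractions
`I ≥ T 0 ≥ T 1 ≥ ⋯ ≥ T n ≥ (1 - δ) I` on `ℝ²` whose product sends `(1,0)` to `(0, 1-δ)`. -/
theorem product_of_positive_contractions_rotates
    (δ : ℝ) (hδ0 : 0 < δ) (hδ1 : δ < 1) :
    ∃ n : ℕ, ∃ T : Fin (n + 1) → (EuclideanSpace ℝ (Fin 2) →L[ℝ] EuclideanSpace ℝ (Fin 2)),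
      (∀ i, IsSelfAdjoint (T i)) ∧
      (∀ i, ∀ ξ, 0 ≤ ⟪T i ξ, ξ⟫_ℝ) ∧
      (∀ i, ∀ ξ, ⟪T i ξ, ξ⟫_ℝ ≤ ⟪ξ, ξ⟫_ℝ) ∧
      (∀ i j : Fin (n + 1), i ≤ j → ∀ ξ, ⟪T j ξ, ξ⟫_ℝ ≤ ⟪T i ξ, ξ⟫_ℝ) ∧
      (∀ ξ, (1 - δ) * ⟪ξ, ξ⟫_ℝ ≤ ⟪T (Fin.last n) ξ, ξ⟫_ℝ) ∧
      ((List.ofFn T).reverse.prod) (vec2 1 0) = vec2 0 (1 - δ) := by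
  obtain ⟨r, hr, hr1, h⟩ := exists_almostReachable_vec2_zero (show 0 < δ / 16 by positivity)
  have hd0 : 0 < 1 - δ := by linarith
  have hεδ : (1 - δ) * δ / 20 ≤ δ / 20 := by nlinarith
  obtain ⟨x, hx, hreach⟩ := h ((1 - δ) * δ / 20) (by positivity) (by linarith)
  obtain ⟨S, hS, hSc, hSx⟩ := exists_symmPlane_apply_smul_eq hδ0 hδ1 hr hr1 hx
  have hc1 : (1 - δ / 4) • (1 : EuclideanSpace ℝ (Fin 2) →L[ℝ] EuclideanSpace ℝ (Fin 2)) ≤ 1 := by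
    simpa using smul_one_le_smul_one (E := EuclideanSpace ℝ (Fin 2))
      (show 1 - δ / 4 ≤ 1 by linarith)
  obtain ⟨n, T, hanti, hone, hlast, hprod⟩ := (hreach.apply
    (smul_one_le_smul_one (show 1 - δ / 4 ≤ 1 - (1 - δ) * δ / 20 by linarith)) hc1).exists_fin
    hSc (hSc.trans hc1)
  have inner_le {A B : EuclideanSpace ℝ (Fin 2) →L[ℝ] EuclideanSpace ℝ (Fin 2)} (hAB : A ≤ B)
      (ξ : EuclideanSpace ℝ (Fin 2)) : ⟪A ξ, ξ⟫_ℝ ≤ ⟪B ξ, ξ⟫_ℝ := by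
    simpa [inner_sub_left] using
      ((ContinuousLinearMap.le_def _ _).1 hAB).inner_nonneg_left ξ
  have hpos (i : Fin (n + 1)) : (T i).IsPositive := by
    rw [← ContinuousLinearMap.nonneg_iff_isPositive]
    refine ((ContinuousLinearMap.nonneg_iff_isPositive _).2
      (ContinuousLinearMap.isPositive_one.smul_of_nonneg hd0.le)).trans ?_
    exact (hlast ▸ hS).trans (hanti _ _ (Fin.le_last i))
  refine ⟨n, T, fun i => (hpos i).isSelfAdjoint, fun i => (hpos i).inner_nonneg_left,
    fun i ξ => by simpa using inner_le (hone i) ξ, fun i j hij => inner_le (hanti i j hij),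
    fun ξ => ?_, ?_⟩
  · simpa [hlast, real_inner_smul_left] using inner_le hS ξ
  · rw [hprod]
    simpa using hSx
end

section
/- Let H be a complex Hilbert space and let S, T be bounded linear operators on H with 0 ≤ S ≤ T. Then there exists a bounded linear operator x on H with ‖x‖ ≤ 1 such that S^{1/2} = x T^{1/2}, and moreover x belongs to the double commutant of {S, T} (equivalently, x commutes with every bounded operator that commutes with both S and T). -/
open scoped InnerProductSpace ComplexOrder

namespace ContinuousLinearMap

section Factor

variable {𝕜 E F G : Type*} [RCLike 𝕜] [AddCommGroup E] [TopologicalSpace E] [Module 𝕜 E]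
  [NormedAddCommGroup F] [InnerProductSpace 𝕜 F] [CompleteSpace F]
  [NormedAddCommGroup G] [NormedSpace 𝕜 G] [CompleteSpace G]

/-- **Douglas factorization**: if `‖A ξ‖ ≤ ‖B ξ‖` for all `ξ`, then `A = x B` for a contraction `x`
vanishing on the orthogonal complement of the range of `B`. -/
theorem exists_contraction_comp_eq_of_norm_le (A : E →L[𝕜] G) (B : E →L[𝕜] F)
    (h : ∀ ξ, ‖A ξ‖ ≤ ‖B ξ‖) :
    ∃ x : F →L[𝕜] G, ‖x‖ ≤ 1 ∧ x.comp B = A ∧ ∀ v ∈ B.rangeᗮ, x v = 0 := by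
  set K : Submodule 𝕜 F := B.range.topologicalClosure
  have : CompleteSpace K := B.range.isClosed_topologicalClosure.completeSpace_coe
  have hBK (ξ : E) : B ξ ∈ K := B.range.le_topologicalClosure ⟨ξ, rfl⟩
  let e : E →ₗ[𝕜] K := B.toLinearMap.codRestrict K hBK
  have h_dense : DenseRange e := by
    rintro ⟨y, hy⟩
    rw [closure_subtype, ← Set.range_comp]
    exact hy
  have h_norm (ξ : E) : ‖A.toLinearMap ξ‖ ≤ 1 * ‖e ξ‖ := by simpa using! h ξ
  refine ⟨(A.toLinearMap.extendOfNorm e).comp K.orthogonalProjectionOnto, ?_, ?_, ?_⟩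
  · refine (opNorm_comp_le _ _).trans ?_
    exact mul_le_one₀ (LinearMap.opNorm_extendOfNorm_le h_dense zero_le_one h_norm)
      (norm_nonneg _) K.orthogonalProjectionOnto_norm_le
  · ext ξ
    have hproj : K.orthogonalProjectionOnto (B ξ) = e ξ :=
      K.orthogonalProjectionOnto_mem_subspace_eq_self (e ξ)
    simpa [hproj] using! LinearMap.extendOfNorm_eq h_dense ⟨1, h_norm⟩ ξ
  · intro v hv
    rw [← Submodule.orthogonal_closure] at hv
    have hproj : K.orthogonalProjectionOnto v = 0 :=
      Submodule.orthogonalProjectionOnto_eq_zero_iff.2 hv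
    rw [comp_apply, hproj, map_zero]

end Factor

section Hilbert

variable {𝕜 H : Type*} [RCLike 𝕜] [NormedAddCommGroup H] [InnerProductSpace 𝕜 H] [CompleteSpace H]

/-- An operator `x` with `x B = A` vanishing on the orthogonal complement of the range of the
self-adjoint operator `B` commutes with every operator that commutes with `A` and `B`. -/
theorem commute_of_comp_eq_of_eq_zero {A B x c : H →L[𝕜] H} (hB : IsSelfAdjoint B)
    (hx : x.comp B = A) (hx0 : ∀ v ∈ B.rangeᗮ, x v = 0) (hcA : Commute A c) (hcB : Commute B c) :
    Commute x c := by
  have hcA' (v : H) : A (c v) = c (A v) := congr($hcA.eq v)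
  have hcB' (v : H) : B (c v) = c (B v) := congr($hcB.eq v)
  have hx' (v : H) : x (B v) = A v := congr($hx v)
  have hker : B.rangeᗮ = B.ker := by
    rw [B.orthogonal_range, hB.adjoint_eq]
  set L : Submodule 𝕜 H := LinearMap.eqLocus (x * c).toLinearMap (c * x).toLinearMap
  have hclosed : IsClosed (L : Set H) := isClosed_eq (x * c).continuous (c * x).continuous
  have hrange : B.range.topologicalClosure ≤ L := by
    refine B.range.topologicalClosure_minimal ?_ hclosed
    rintro _ ⟨ξ, rfl⟩
    change x (c (B ξ)) = c (x (B ξ))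
    rw [← hcB', hx', hx', hcA']
  have horth : B.range.topologicalClosureᗮ ≤ L := by
    intro v hv
    rw [Submodule.orthogonal_closure] at hv
    have hcv : c v ∈ B.rangeᗮ := by
      rw [hker] at hv ⊢
      have hv' : B v = 0 := hv
      change B (c v) = 0
      rw [hcB', hv', map_zero]
    change x (c v) = c (x v)
    rw [hx0 v hv, hx0 _ hcv, map_zero]
  have : CompleteSpace B.range.topologicalClosure :=
    B.range.isClosed_topologicalClosure.completeSpace_coe
  have htop : ⊤ ≤ L := by
    rw [← Submodule.sup_orthogonal_of_hasOrthogonalProjection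
      (K := B.range.topologicalClosure)]
    exact sup_le hrange horth
  ext v
  exact htop (Submodule.mem_top : v ∈ ⊤)

end Hilbert

section Complex

variable {H : Type*} [NormedAddCommGroup H] [InnerProductSpace ℂ H]

theorem isPositive_of_forall_inner_nonneg {A : H →L[ℂ] H} (hA : ∀ ξ : H, 0 ≤ ⟪A ξ, ξ⟫_ℂ) :
    A.IsPositive := by
  refine (isPositive_iff_complex A).2 fun ξ ↦ ?_
  obtain ⟨hre, him⟩ := Complex.nonneg_iff.1 (hA ξ)
  exact ⟨Complex.ext rfl him, hre⟩

/-- A positive operator commutes with whatever commutes with its square. -/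
theorem IsPositive.commute_of_commute_comp_self [CompleteSpace H] {A c : H →L[ℂ] H}
    (hA : A.IsPositive) (h : Commute (A.comp A) c) : Commute A c := by
  rw [← CFC.sqrt_mul_self A (nonneg_iff_isPositive A |>.2 hA)]
  exact h.cfcₙ_nnreal _

end Complex

end ContinuousLinearMap

open ContinuousLinearMap in
/-- If `0 ≤ S ≤ T`, there is a contraction `x` in the double commutant of `{S, T}`
with `S^{1/2} = x T^{1/2}`. -/
theorem exists_contraction_sqrt_factor
    {H : Type*} [NormedAddCommGroup H] [InnerProductSpace ℂ H] [CompleteSpace H]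
    (S T Ssq Tsq : H →L[ℂ] H)
    (hSpos : ∀ ξ : H, 0 ≤ ⟪S ξ, ξ⟫_ℂ)
    (hST : ∀ ξ : H, ⟪S ξ, ξ⟫_ℂ ≤ ⟪T ξ, ξ⟫_ℂ)
    (hSsqPos : ∀ ξ : H, 0 ≤ ⟪Ssq ξ, ξ⟫_ℂ)
    (hSsq : Ssq.comp Ssq = S)
    (hTsqPos : ∀ ξ : H, 0 ≤ ⟪Tsq ξ, ξ⟫_ℂ)
    (hTsq : Tsq.comp Tsq = T) :
    ∃ x : H →L[ℂ] H, ‖x‖ ≤ 1 ∧ Ssq = x.comp Tsq ∧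
      x ∈ Set.centralizer (Set.centralizer {S, T}) := by
  have hA := isPositive_of_forall_inner_nonneg hSsqPos
  have hB := isPositive_of_forall_inner_nonneg hTsqPos
  have hnorm (ξ : H) : ‖Ssq ξ‖ ≤ ‖Tsq ξ‖ := by
    have h := hST ξ
    rw [← hSsq, ← hTsq, comp_apply, comp_apply, hA.isSymmetric.apply_clm, hB.isSymmetric.apply_clm,
      inner_self_eq_norm_sq_to_K, inner_self_eq_norm_sq_to_K] at h
    norm_cast at h
    exact le_of_sq_le_sq h (norm_nonneg _)
  obtain ⟨x, hx1, hx, hx0⟩ := exists_contraction_comp_eq_of_norm_le Ssq Tsq hnorm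
  refine ⟨x, hx1, hx.symm, fun c hc ↦ ?_⟩
  have hcS : Commute (Ssq.comp Ssq) c := hSsq ▸ hc S (by simp)
  have hcT : Commute (Tsq.comp Tsq) c := hTsq ▸ hc T (by simp)
  exact (commute_of_comp_eq_of_eq_zero hB.isSelfAdjoint hx hx0
    (hA.commute_of_commute_comp_self hcS) (hB.commute_of_commute_comp_self hcT)).eq.symm
end

section
/- Let H be a complex Hilbert space, T_1 ≥ T_2 ≥ ⋯ a decreasing sequence of positive linear contractions on H, T the strong operator limit of (T_n), and P the orthogonal projection onto {ξ ∈ H : Tξ = ξ}. Assume ∑_{n=1}^∞ ‖T − T_n‖ < ∞. Then for every proper σ : ℕ → ℕ with sup_{n∈ℕ} #σ⁻¹({n}) < ∞, and every ξ ∈ H, ‖T_{σ(n)} ⋯ T_{σ(1)} ξ − P ξ‖ → 0. -/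
open Filter Topology
open scoped InnerProductSpace ComplexOrder

theorem summable_comp_of_ncard_fiber_le {f : ℕ → ℝ} (hf : ∀ k, 0 ≤ f k) (hsum : Summable f)
    {σ : ℕ → ℕ} (hσ : ∀ k, (σ ⁻¹' {k}).Finite) {M : ℕ} (hM : ∀ k, (σ ⁻¹' {k}).ncard ≤ M) :
    Summable fun n => f (σ n) := by
  refine summable_of_sum_range_le (c := M * ∑' k, f k) (fun n => hf _) fun n => ?_
  rw [Finset.sum_comp f σ]
  calc ∑ b ∈ (Finset.range n).image σ, ((Finset.range n).filter fun a => σ a = b).card • f b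
      ≤ ∑ b ∈ (Finset.range n).image σ, M * f b := by
        refine Finset.sum_le_sum fun b _ => ?_
        rw [nsmul_eq_mul]
        refine mul_le_mul_of_nonneg_right (Nat.cast_le.2 (le_trans ?_ (hM b))) (hf b)
        rw [← Set.ncard_coe_finset]
        refine Set.ncard_le_ncard (fun a ha => ?_) (hσ b)
        simpa using (Finset.mem_filter.1 ha).2
    _ = M * ∑ b ∈ (Finset.range n).image σ, f b := by rw [Finset.mul_sum]
    _ ≤ M * ∑' k, f k :=
        mul_le_mul_of_nonneg_left (hsum.sum_le_tsum _ fun k _ => hf k) (Nat.cast_nonneg M)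

section PositiveContraction

variable {H : Type*} [NormedAddCommGroup H] [InnerProductSpace ℂ H]

theorem ContinuousLinearMap.norm_apply_le_of_norm_le_one {A : H →L[ℂ] H} (hA : ‖A‖ ≤ 1) (x : H) :
    ‖A x‖ ≤ ‖x‖ :=
  (A.le_of_opNorm_le hA x).trans_eq (one_mul _)

theorem ContinuousLinearMap.re_inner_apply_self_le_norm_sq {A : H →L[ℂ] H} (hA : ‖A‖ ≤ 1) (x : H) :
    (⟪A x, x⟫_ℂ).re ≤ ‖x‖ ^ 2 :=
  calc (⟪A x, x⟫_ℂ).re ≤ ‖A x‖ * ‖x‖ := re_inner_le_norm (𝕜 := ℂ) (A x) x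
    _ ≤ ‖x‖ * ‖x‖ := by gcongr; exact norm_apply_le_of_norm_le_one hA x
    _ = ‖x‖ ^ 2 := (sq _).symm

theorem isSymmetric_of_inner_apply_self_nonneg {A : H →L[ℂ] H}
    (hA : ∀ x : H, 0 ≤ ⟪A x, x⟫_ℂ) : (A : H →ₗ[ℂ] H).IsSymmetric := by
  rw [LinearMap.isSymmetric_iff_inner_map_self_real]
  intro x
  exact Complex.conj_eq_iff_im.2 (Complex.nonneg_iff.1 (hA x)).2.symm

theorem LinearMap.IsSymmetric.norm_apply_sq_le_re_inner {A : H →L[ℂ] H}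
    (hsymm : (A : H →ₗ[ℂ] H).IsSymmetric) (hpos : ∀ x : H, 0 ≤ (⟪A x, x⟫_ℂ).re)
    (hA : ‖A‖ ≤ 1) (x : H) : ‖A x‖ ^ 2 ≤ (⟪A x, x⟫_ℂ).re := by
  have h := hpos (x - A x)
  have hx : ⟪A (A x), x⟫_ℂ = ⟪A x, A x⟫_ℂ := hsymm (A x) x
  have hn : (⟪A x, A x⟫_ℂ).re = ‖A x‖ ^ 2 := inner_self_eq_norm_sq (𝕜 := ℂ) (A x)
  rw [map_sub, inner_sub_left, inner_sub_right, inner_sub_right, hx] at h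
  simp only [Complex.sub_re, hn] at h
  linarith [ContinuousLinearMap.re_inner_apply_self_le_norm_sq hA (A x)]

theorem LinearMap.IsSymmetric.inner_pow_pow {A : H →L[ℂ] H}
    (hsymm : (A : H →ₗ[ℂ] H).IsSymmetric) (m n : ℕ) (x y : H) :
    ⟪(A ^ m) x, (A ^ n) y⟫_ℂ = ⟪(A ^ (m + n)) x, y⟫_ℂ := by
  induction n generalizing m with
  | zero => simp
  | succ n ih =>
    rw [show m + (n + 1) = (m + 1) + n by ring, ← ih (m + 1), pow_succ' A n, pow_succ' A m]
    exact (hsymm ((A ^ m) x) ((A ^ n) y)).symm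

theorem antitone_re_inner_pow {A : H →L[ℂ] H} (hpos : ∀ x : H, 0 ≤ ⟪A x, x⟫_ℂ)
    (hA : ‖A‖ ≤ 1) (x : H) : Antitone fun n => (⟪(A ^ n) x, x⟫_ℂ).re := by
  have hsymm := isSymmetric_of_inner_apply_self_nonneg hpos
  refine antitone_nat_of_succ_le fun n => ?_
  have hn (y : H) : (⟪y, y⟫_ℂ).re = ‖y‖ ^ 2 := inner_self_eq_norm_sq (𝕜 := ℂ) y
  obtain ⟨k, rfl | rfl⟩ := n.even_or_odd'
  · rw [show 2 * k + 1 = (k + 1) + k by ring, show 2 * k = k + k by ring,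
      ← hsymm.inner_pow_pow (k + 1) k, ← hsymm.inner_pow_pow k k, hn, pow_succ']
    exact ContinuousLinearMap.re_inner_apply_self_le_norm_sq hA _
  · rw [show 2 * k + 1 + 1 = (k + 1) + (k + 1) by ring, show 2 * k + 1 = (k + 1) + k by ring,
      ← hsymm.inner_pow_pow (k + 1) (k + 1), ← hsymm.inner_pow_pow (k + 1) k, hn, pow_succ' A k]
    exact hsymm.norm_apply_sq_le_re_inner (fun y => (Complex.nonneg_iff.1 (hpos y)).1) hA _

theorem cauchySeq_pow_apply {A : H →L[ℂ] H} (hpos : ∀ x : H, 0 ≤ ⟪A x, x⟫_ℂ)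
    (hA : ‖A‖ ≤ 1) (x : H) : CauchySeq fun n => (A ^ n) x := by
  have hsymm := isSymmetric_of_inner_apply_self_nonneg hpos
  set a : ℕ → ℝ := fun n => (⟪(A ^ n) x, x⟫_ℂ).re with ha
  have hn (y : H) : (⟪y, y⟫_ℂ).re = ‖y‖ ^ 2 := inner_self_eq_norm_sq (𝕜 := ℂ) y
  have hdist (m n : ℕ) : ‖(A ^ m) x - (A ^ n) x‖ ^ 2 = a (m + m) - 2 * a (m + n) + a (n + n) := by
    rw [← hn, inner_sub_left, inner_sub_right, inner_sub_right]
    simp only [hsymm.inner_pow_pow, Complex.sub_re, ha, add_comm n m]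
    ring
  have hanti : Antitone a := antitone_re_inner_pow hpos hA x
  have hbdd : BddBelow (Set.range a) := by
    refine ⟨-(‖x‖ ^ 2), ?_⟩
    rintro _ ⟨n, rfl⟩
    have h0 : 0 ≤ a (n + n) := by
      rw [ha]
      simp only [← hsymm.inner_pow_pow, hn]
      positivity
    nlinarith [hanti (Nat.le_add_left n n), sq_nonneg ‖x‖]
  have hlim := tendsto_atTop_ciInf hanti hbdd
  have hcau := Metric.cauchySeq_iff.1 hlim.cauchySeq
  refine Metric.cauchySeq_iff.2 fun ε hε => ?_
  obtain ⟨N, hN⟩ := hcau (ε ^ 2 / 2) (by positivity)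
  refine ⟨N, fun m hm n hn' => ?_⟩
  have h1 := hN (m + m) (by omega) (m + n) (by omega)
  have h2 := hN (n + n) (by omega) (m + n) (by omega)
  rw [Real.dist_eq] at h1 h2
  rw [dist_eq_norm]
  refine lt_of_pow_lt_pow_left₀ 2 hε.le ?_
  rw [hdist]
  linarith [(abs_lt.1 h1).2, (abs_lt.1 h2).2]

theorem inner_apply_eq_of_apply_eq {A : H →L[ℂ] H} (hsymm : (A : H →ₗ[ℂ] H).IsSymmetric)
    {η : H} (hη : A η = η) (x : H) : ⟪A x, η⟫_ℂ = ⟪x, η⟫_ℂ :=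
  (hsymm x η).trans (by simp [hη])

theorem eq_of_fixed_of_inner_sub_eq_zero {A P : H →L[ℂ] H} (hPmem : ∀ ξ : H, A (P ξ) = P ξ)
    (hPorth : ∀ ξ η : H, A η = η → ⟪ξ - P ξ, η⟫_ℂ = 0) {x y : H} (hy : A y = y)
    (hxy : ∀ η, A η = η → ⟪x - y, η⟫_ℂ = 0) : P x = y := by
  have hfix : A (P x - y) = P x - y := by rw [map_sub, hPmem, hy]
  have h := congrArg₂ (· - ·) (hxy _ hfix) (hPorth x _ hfix)
  simp only [← inner_sub_left, sub_sub_sub_cancel_left, sub_zero] at h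
  exact sub_eq_zero.1 (inner_self_eq_zero.1 h)

theorem tendsto_pow_apply [CompleteSpace H] {A P : H →L[ℂ] H} (hpos : ∀ x : H, 0 ≤ ⟪A x, x⟫_ℂ)
    (hA : ‖A‖ ≤ 1) (hPmem : ∀ ξ : H, A (P ξ) = P ξ)
    (hPorth : ∀ ξ η : H, A η = η → ⟪ξ - P ξ, η⟫_ℂ = 0) (x : H) :
    Tendsto (fun n => (A ^ n) x) atTop (𝓝 (P x)) := by
  have hsymm := isSymmetric_of_inner_apply_self_nonneg hpos
  obtain ⟨y, hy⟩ := cauchySeq_tendsto_of_complete (cauchySeq_pow_apply hpos hA x)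
  have hAy : A y = y := by
    refine tendsto_nhds_unique ((A.continuous.tendsto y).comp hy) ?_
    refine ((tendsto_add_atTop_iff_nat 1).2 hy).congr fun n => ?_
    simp [pow_succ']
  rwa [eq_of_fixed_of_inner_sub_eq_zero hPmem hPorth hAy]
  intro η hη
  have hconst (n : ℕ) : ⟪(A ^ n) x, η⟫_ℂ = ⟪x, η⟫_ℂ := by
    induction n with
    | zero => simp
    | succ n ih =>
      rw [pow_succ', ← ih]
      exact inner_apply_eq_of_apply_eq hsymm hη _
  have hlim : Tendsto (fun n => ⟪(A ^ n) x, η⟫_ℂ) atTop (𝓝 ⟪y, η⟫_ℂ) :=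
    hy.inner tendsto_const_nhds
  simp only [hconst] at hlim
  rw [inner_sub_left, tendsto_nhds_unique tendsto_const_nhds hlim, sub_self]

theorem apply_eq_of_inner_le {A B : H →L[ℂ] H} (hB : ‖B‖ ≤ 1) {η : H} (hη : A η = η)
    (hAB : ⟪A η, η⟫_ℂ ≤ ⟪B η, η⟫_ℂ) : B η = η := by
  have h := (Complex.le_def.1 hAB).1
  have hn : (⟪η, η⟫_ℂ).re = ‖η‖ ^ 2 := inner_self_eq_norm_sq (𝕜 := ℂ) η
  rw [hη, hn] at h
  have hsub : ‖B η - η‖ ^ 2 = ‖B η‖ ^ 2 - 2 * (⟪B η, η⟫_ℂ).re + ‖η‖ ^ 2 :=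
    norm_sub_sq (𝕜 := ℂ) (B η) η
  have hle : ‖B η‖ ^ 2 ≤ ‖η‖ ^ 2 :=
    pow_le_pow_left₀ (norm_nonneg _) (ContinuousLinearMap.norm_apply_le_of_norm_le_one hB η) 2
  have h0 : ‖B η - η‖ = 0 := pow_eq_zero_iff two_ne_zero |>.1 (by nlinarith [sq_nonneg ‖B η - η‖])
  exact sub_eq_zero.1 (norm_eq_zero.1 h0)

theorem norm_prodSeq_apply_le {T : ℕ → H →L[ℂ] H} (hcontr : ∀ n, ‖T n‖ ≤ 1) (σ : ℕ → ℕ)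
    (n : ℕ) (ξ : H) : ‖prodSeq T σ n ξ‖ ≤ ‖ξ‖ := by
  induction n with
  | zero => exact ContinuousLinearMap.norm_apply_le_of_norm_le_one (hcontr _) ξ
  | succ n ih => exact (ContinuousLinearMap.norm_apply_le_of_norm_le_one (hcontr _) _).trans ih

theorem norm_prodSeq_add_sub_pow_le {T : ℕ → H →L[ℂ] H} (hcontr : ∀ n, ‖T n‖ ≤ 1)
    {A : H →L[ℂ] H} (hA : ‖A‖ ≤ 1) (σ : ℕ → ℕ) (m j : ℕ) (ξ : H) :
    ‖prodSeq T σ (m + j) ξ - (A ^ j) (prodSeq T σ m ξ)‖ ≤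
      (∑ i ∈ Finset.range j, ‖A - T (σ (i + (m + 1)))‖) * ‖ξ‖ := by
  induction j with
  | zero => simp
  | succ j ih =>
    have hsplit : prodSeq T σ (m + (j + 1)) ξ - (A ^ (j + 1)) (prodSeq T σ m ξ) =
        A (prodSeq T σ (m + j) ξ - (A ^ j) (prodSeq T σ m ξ)) -
          (A - T (σ (j + (m + 1)))) (prodSeq T σ (m + j) ξ) := by
      rw [show j + (m + 1) = m + j + 1 by ring, pow_succ']
      change T (σ (m + j + 1)) (prodSeq T σ (m + j) ξ) - A ((A ^ j) (prodSeq T σ m ξ)) = _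
      simp only [map_sub, sub_apply]
      abel
    rw [hsplit, Finset.sum_range_succ, add_mul]
    refine (norm_sub_le _ _).trans (add_le_add ?_ ?_)
    · exact (ContinuousLinearMap.norm_apply_le_of_norm_le_one hA _).trans ih
    · exact (ContinuousLinearMap.le_opNorm _ _).trans
        (mul_le_mul_of_nonneg_left (norm_prodSeq_apply_le hcontr σ _ ξ) (norm_nonneg _))

end PositiveContraction

/-- If `∑ ‖Tlim - T n‖ < ∞`, then for every proper `σ` with uniformly finite fibers,
`S_n^σ ξ → P ξ` for every `ξ`. -/
theorem generalized_paszkiewicz_of_summable_norms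
    {H : Type*} [NormedAddCommGroup H] [InnerProductSpace ℂ H] [CompleteSpace H]
    (T : ℕ → H →L[ℂ] H)
    (hpos : ∀ n, ∀ ξ : H, 0 ≤ ⟪(T n) ξ, ξ⟫_ℂ)
    (hcontr : ∀ n, ‖T n‖ ≤ 1)
    (hdec : ∀ n, ∀ ξ : H, ⟪(T (n + 1)) ξ, ξ⟫_ℂ ≤ ⟪(T n) ξ, ξ⟫_ℂ)
    (Tlim : H →L[ℂ] H)
    (hTlim : ∀ ξ : H, Tendsto (fun n => (T n) ξ) atTop (𝓝 (Tlim ξ)))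
    (P : H →L[ℂ] H)
    (hPmem : ∀ ξ : H, Tlim (P ξ) = P ξ)
    (hPorth : ∀ ξ η : H, Tlim η = η → ⟪ξ - P ξ, η⟫_ℂ = 0)
    (hsum : Summable fun n => ‖Tlim - T n‖)
    (σ : ℕ → ℕ) (hσ : ∀ k, (σ ⁻¹' {k}).Finite)
    (hbd : ∃ M : ℕ, ∀ k, (σ ⁻¹' {k}).ncard ≤ M) :
    ∀ ξ : H, Tendsto (fun n => prodSeq T σ n ξ) atTop (𝓝 (P ξ)) := by
  obtain ⟨M, hM⟩ := hbd
  intro ξ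
  have hlim (x : H) : Tendsto (fun n => ⟪T n x, x⟫_ℂ) atTop (𝓝 ⟪Tlim x, x⟫_ℂ) :=
    (hTlim x).inner tendsto_const_nhds
  have hpos' (x : H) : 0 ≤ ⟪Tlim x, x⟫_ℂ := ge_of_tendsto' (hlim x) fun n => hpos n x
  have hle (n : ℕ) (x : H) : ⟪Tlim x, x⟫_ℂ ≤ ⟪T n x, x⟫_ℂ :=
    (antitone_nat_of_succ_le fun n => hdec n x).le_of_tendsto (hlim x) n
  have hTlim1 : ‖Tlim‖ ≤ 1 := by
    refine ContinuousLinearMap.opNorm_le_bound _ zero_le_one fun x => ?_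
    rw [one_mul]
    exact le_of_tendsto' (hTlim x).norm fun n =>
      ContinuousLinearMap.norm_apply_le_of_norm_le_one (hcontr n) x
  have hPT (n : ℕ) (x : H) : P (T n x) = P x := by
    refine eq_of_fixed_of_inner_sub_eq_zero hPmem hPorth (hPmem x) fun η hη => ?_
    rw [inner_sub_left, inner_apply_eq_of_apply_eq
      (isSymmetric_of_inner_apply_self_nonneg (hpos n))
      (apply_eq_of_inner_le (hcontr n) hη (hle n η)), ← inner_sub_left]
    exact hPorth x η hη
  have hPS (m : ℕ) : P (prodSeq T σ m ξ) = P ξ := by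
    induction m with
    | zero => exact hPT _ _
    | succ m ih => exact (hPT _ _).trans ih
  have hsumσ : Summable fun n => ‖Tlim - T (σ n)‖ :=
    summable_comp_of_ncard_fiber_le (fun k => norm_nonneg (Tlim - T k)) hsum hσ hM
  have htail : Tendsto (fun m => (∑' i, ‖Tlim - T (σ (i + (m + 1)))‖) * ‖ξ‖) atTop (𝓝 0) := by
    have h := (tendsto_add_atTop_iff_nat 1).2
      (tendsto_sum_nat_add fun n => ‖Tlim - T (σ n)‖)
    simpa using h.mul_const ‖ξ‖
  refine Metric.tendsto_atTop.2 fun ε hε => ?_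
  obtain ⟨m, hm⟩ := (htail.eventually_lt_const (half_pos hε)).exists
  have hpow := tendsto_pow_apply hpos' hTlim1 hPmem hPorth (prodSeq T σ m ξ)
  rw [hPS] at hpow
  obtain ⟨J, hJ⟩ := Metric.tendsto_atTop.1 hpow (ε / 2) (half_pos hε)
  refine ⟨m + J, fun n hn => ?_⟩
  obtain ⟨j, rfl⟩ := Nat.exists_eq_add_of_le ((Nat.le_add_right m J).trans hn)
  have hfirst : dist (prodSeq T σ (m + j) ξ) ((Tlim ^ j) (prodSeq T σ m ξ)) < ε / 2 := by
    rw [dist_eq_norm]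
    refine (norm_prodSeq_add_sub_pow_le hcontr hTlim1 σ m j ξ).trans_lt (lt_of_le_of_lt ?_ hm)
    refine mul_le_mul_of_nonneg_right ?_ (norm_nonneg ξ)
    exact ((summable_nat_add_iff (m + 1)).2 hsumσ).sum_le_tsum _ fun i _ => norm_nonneg _
  have hsecond := hJ j (by omega)
  exact (dist_triangle _ _ _).trans_lt (by linarith)
end
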